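/- arXiv:2209.00999 — 2 statements merged into one kernel-verified Lean document; each statement's English description precedes it below -/
import Mathlib

section
/- There exists a universal constant C > 0 such that for every integer N ≥ 1, every choice of parameters p_1, …, p_N ∈ (0, 1/2], and every non-constant Boolean function f : {0,1}^N → {0,1}, one has ∑_{i=1}^N p_i · |log p_i| · Inf_i(f) ≥ C · Var(f) · log( 1 / max_{1 ≤ i ≤ N} ( p_i · Inf_i(f) ) ), where the influences and variance are taken with respect to the product Bernoulli measure P_{p_1,…,p_N}. -/
/-- Expectation of `f` under the product Bernoulli measure with parameters `p`. -/
noncomputable def bernoulliExp {N : ℕ} (p : Fin N → ℝ) (f : (Fin N → Bool) → ℝ) : ℝ :=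
  ∑ x : Fin N → Bool, (∏ i, if x i then p i else 1 - p i) * f x

/-- Discrete derivative of `f` in the `i`-th coordinate. -/
def flipDiff {N : ℕ} (i : Fin N) (f : (Fin N → Bool) → ℝ) (x : Fin N → Bool) : ℝ :=
  f (Function.update x i (!x i)) - f x

/-- Restriction of `f` to the configurations whose first coordinate is `b`. -/
def headRestrict {N : ℕ} (b : Bool) (f : (Fin (N + 1) → Bool) → ℝ) (y : Fin N → Bool) : ℝ :=
  f (Fin.cons b y)

section Expectation

variable {N : ℕ}

theorem bernoulliExp_add (p : Fin N → ℝ) (f g : (Fin N → Bool) → ℝ) :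
    bernoulliExp p (fun x => f x + g x) = bernoulliExp p f + bernoulliExp p g := by
  simp [bernoulliExp, mul_add, Finset.sum_add_distrib]

theorem bernoulliExp_const_mul (p : Fin N → ℝ) (c : ℝ) (f : (Fin N → Bool) → ℝ) :
    bernoulliExp p (fun x => c * f x) = c * bernoulliExp p f := by
  simp only [bernoulliExp, Finset.mul_sum]
  exact Finset.sum_congr rfl fun x _ => by ring

theorem bernoulliExp_zero_dim (p : Fin 0 → ℝ) (f : (Fin 0 → Bool) → ℝ) :
    bernoulliExp p f = f default := by
  simp only [bernoulliExp, Fintype.sum_unique, Finset.univ_eq_empty, Finset.prod_empty, one_mul]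
  exact congrArg f (Subsingleton.elim _ _)

theorem bernoulliExp_succ (p : Fin (N + 1) → ℝ) (f : (Fin (N + 1) → Bool) → ℝ) :
    bernoulliExp p f = p 0 * bernoulliExp (Fin.tail p) (headRestrict true f)
      + (1 - p 0) * bernoulliExp (Fin.tail p) (headRestrict false f) := by
  unfold bernoulliExp headRestrict
  rw [← (Fin.consEquiv (fun _ : Fin (N + 1) => Bool)).sum_comp, Fintype.sum_prod_type]
  simp only [Fintype.sum_bool, Fin.consEquiv_apply, Fin.prod_univ_succ, Fin.cons_zero,
    Fin.cons_succ, Finset.mul_sum, Fin.tail]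
  congr 1 <;> exact Finset.sum_congr rfl fun x _ => by simp [mul_assoc, Fin.consEquiv]

theorem bernoulli_weight_nonneg {p : Fin N → ℝ} (hp : ∀ i, p i ∈ Set.Ioc (0 : ℝ) (1 / 2))
    (x : Fin N → Bool) : 0 ≤ ∏ i, if x i then p i else 1 - p i := by
  refine Finset.prod_nonneg fun i _ => ?_
  have := hp i
  rw [Set.mem_Ioc] at this
  split_ifs <;> linarith

variable {p : Fin N → ℝ}

theorem bernoulliExp_mono (hp : ∀ i, p i ∈ Set.Ioc (0 : ℝ) (1 / 2))
    {f g : (Fin N → Bool) → ℝ} (h : ∀ x, f x ≤ g x) :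
    bernoulliExp p f ≤ bernoulliExp p g :=
  Finset.sum_le_sum fun x _ => mul_le_mul_of_nonneg_left (h x) (bernoulli_weight_nonneg hp x)

theorem bernoulliExp_nonneg (hp : ∀ i, p i ∈ Set.Ioc (0 : ℝ) (1 / 2))
    {f : (Fin N → Bool) → ℝ} (h : ∀ x, 0 ≤ f x) : 0 ≤ bernoulliExp p f :=
  Finset.sum_nonneg fun x _ => mul_nonneg (bernoulli_weight_nonneg hp x) (h x)

theorem bernoulliExp_one (p : Fin N → ℝ) : bernoulliExp p (fun _ => 1) = 1 := by
  induction N with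
  | zero => simp [bernoulliExp_zero_dim]
  | succ N ih =>
    rw [bernoulliExp_succ]
    have h (b : Bool) : headRestrict (N := N) b (fun _ => (1 : ℝ)) = fun _ => 1 := rfl
    rw [h, h, ih]
    ring

theorem sq_bernoulliExp_mul_le (hp : ∀ i, p i ∈ Set.Ioc (0 : ℝ) (1 / 2))
    (f g : (Fin N → Bool) → ℝ) :
    bernoulliExp p (fun x => f x * g x) ^ 2
      ≤ bernoulliExp p (fun x => f x ^ 2) * bernoulliExp p (fun x => g x ^ 2) :=
  Finset.sum_sq_le_sum_mul_sum_of_sq_le_mul _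
    (fun x _ => mul_nonneg (bernoulli_weight_nonneg hp x) (sq_nonneg _))
    (fun x _ => mul_nonneg (bernoulli_weight_nonneg hp x) (sq_nonneg _))
    (fun x _ => le_of_eq (by ring))

theorem sq_sqrt_bernoulliExp_sub_le (hp : ∀ i, p i ∈ Set.Ioc (0 : ℝ) (1 / 2))
    (f g : (Fin N → Bool) → ℝ) :
    (√(bernoulliExp p (fun x => f x ^ 2)) - √(bernoulliExp p (fun x => g x ^ 2))) ^ 2
      ≤ bernoulliExp p (fun x => (f x - g x) ^ 2) := by
  have hf : 0 ≤ bernoulliExp p (fun x => f x ^ 2) := bernoulliExp_nonneg hp fun _ => sq_nonneg _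
  have hg : 0 ≤ bernoulliExp p (fun x => g x ^ 2) := bernoulliExp_nonneg hp fun _ => sq_nonneg _
  have hfg : bernoulliExp p (fun x => f x * g x)
      ≤ √(bernoulliExp p (fun x => f x ^ 2)) * √(bernoulliExp p (fun x => g x ^ 2)) := by
    rw [← Real.sqrt_mul hf]
    exact Real.le_sqrt_of_sq_le (sq_bernoulliExp_mul_le hp f g)
  have expand : bernoulliExp p (fun x => (f x - g x) ^ 2)
      = bernoulliExp p (fun x => f x ^ 2) + bernoulliExp p (fun x => g x ^ 2)
        + (-2) * bernoulliExp p (fun x => f x * g x) := by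
    rw [← bernoulliExp_const_mul, ← bernoulliExp_add, ← bernoulliExp_add]
    congr 1
    ext x
    ring
  rw [expand, sub_sq, Real.sq_sqrt hf, Real.sq_sqrt hg]
  linarith

theorem flipDiff_succ_headRestrict (i : Fin N) (b : Bool) (f : (Fin (N + 1) → Bool) → ℝ)
    (y : Fin N → Bool) :
    flipDiff i.succ f (Fin.cons b y) = flipDiff i (headRestrict b f) y := by
  simp [flipDiff, headRestrict, Fin.cons_update]

theorem flipDiff_zero_cons (b : Bool) (f : (Fin (N + 1) → Bool) → ℝ) (y : Fin N → Bool) :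
    flipDiff 0 f (Fin.cons b y) = headRestrict (!b) f y - headRestrict b f y := by
  simp [flipDiff, headRestrict, Fin.update_cons_zero]

theorem bernoulliExp_flipDiff_succ (p : Fin (N + 1) → ℝ) (φ : ℝ → ℝ) (i : Fin N)
    (f : (Fin (N + 1) → Bool) → ℝ) :
    bernoulliExp p (fun x => φ (flipDiff i.succ f x))
      = p 0 * bernoulliExp (Fin.tail p) (fun y => φ (flipDiff i (headRestrict true f) y))
        + (1 - p 0)
          * bernoulliExp (Fin.tail p) (fun y => φ (flipDiff i (headRestrict false f) y)) := by
  rw [bernoulliExp_succ]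
  unfold headRestrict
  simp only [flipDiff_succ_headRestrict]
  rfl

theorem bernoulliExp_flipDiff_zero (p : Fin (N + 1) → ℝ) {φ : ℝ → ℝ} (hφ : φ.Even)
    (f : (Fin (N + 1) → Bool) → ℝ) :
    bernoulliExp p (fun x => φ (flipDiff 0 f x))
      = bernoulliExp (Fin.tail p)
          (fun y => φ (headRestrict true f y - headRestrict false f y)) := by
  have h (y) : φ (headRestrict false f y - headRestrict true f y)
      = φ (headRestrict true f y - headRestrict false f y) := by rw [← hφ, neg_sub]
  rw [bernoulliExp_succ]
  have e (b : Bool) : headRestrict b (fun x => φ (flipDiff 0 f x))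
      = fun y => φ (headRestrict true f y - headRestrict false f y) := by
    ext y
    change φ (flipDiff 0 f (Fin.cons b y)) = _
    rw [flipDiff_zero_cons]
    cases b <;> simp [h]
  rw [e, e]
  ring

end Expectation

/-- Logarithmic Sobolev inequality on the two-point space. -/
theorem two_point_log_sobolev {p a b : ℝ} (hp : p ∈ Set.Ioc (0 : ℝ) (1 / 2))
    (ha : 0 ≤ a) (hb : 0 ≤ b) :
    p * (a ^ 2 * Real.log (a ^ 2)) + (1 - p) * (b ^ 2 * Real.log (b ^ 2))
        - (p * a ^ 2 + (1 - p) * b ^ 2) * Real.log (p * a ^ 2 + (1 - p) * b ^ 2)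
      ≤ 14 * (-Real.log p) * p * (a - b) ^ 2 := by
  obtain ⟨hp0, hp2⟩ := hp
  have hL : 0.69 ≤ -Real.log p := by
    have h1 := Real.log_le_log hp0 hp2
    rw [one_div, Real.log_inv] at h1
    have := Real.log_two_gt_d9
    linarith
  set L := -Real.log p with hLdef
  have hq : 0 < 1 - p := by linarith
  have hab : 0 ≤ p * (a - b) ^ 2 := by positivity
  rcases le_or_gt (2 * b) a with h | h
  · rcases ha.eq_or_lt with rfl | ha'
    · have : b = 0 := by linarith
      simp [this]
    set m := p * a ^ 2 + (1 - p) * b ^ 2 with hm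
    have hm0 : 0 < m := by positivity
    have h1 : Real.log (a ^ 2) - Real.log m ≤ L := by
      have : Real.log (p * a ^ 2) ≤ Real.log m :=
        Real.log_le_log (by positivity) (by rw [hm]; nlinarith [sq_nonneg b])
      rw [Real.log_mul hp0.ne' (by positivity)] at this
      linarith
    have h2 : (1 - p) * (b ^ 2 * (Real.log (b ^ 2) - Real.log m)) ≤ p * b ^ 2 := by
      rcases hb.eq_or_lt with rfl | hb'
      · simp
      have h3 : Real.log ((1 - p) * b ^ 2) ≤ Real.log m :=
        Real.log_le_log (by positivity) (by rw [hm]; nlinarith [sq_nonneg a])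
      rw [Real.log_mul hq.ne' (by positivity)] at h3
      have h4 := Real.one_sub_inv_le_log_of_pos hq
      have h5 : Real.log (b ^ 2) - Real.log m ≤ (1 - p)⁻¹ - 1 := by linarith
      calc (1 - p) * (b ^ 2 * (Real.log (b ^ 2) - Real.log m))
          ≤ (1 - p) * (b ^ 2 * ((1 - p)⁻¹ - 1)) := by gcongr
        _ = p * b ^ 2 := by field_simp; ring
    have h6 : p * (a ^ 2 * (Real.log (a ^ 2) - Real.log m)) ≤ p * (a ^ 2 * L) := by gcongr
    have h7 : a ^ 2 ≤ 4 * (a - b) ^ 2 := by nlinarith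
    have h8 : b ^ 2 ≤ (a - b) ^ 2 := by nlinarith
    have h9 : p * (a ^ 2 * L) ≤ p * (4 * (a - b) ^ 2 * L) := by gcongr
    have h10 : p * b ^ 2 ≤ p * (a - b) ^ 2 := by gcongr
    have : p * (a - b) ^ 2 * 0.69 ≤ p * (a - b) ^ 2 * L := by gcongr
    rw [hm] at *
    nlinarith
  · have hb' : 0 < b := by linarith
    set m := p * a ^ 2 + (1 - p) * b ^ 2 with hm
    have hm0 : 0 < m := by positivity
    have h1 : m - b ^ 2 ≤ m * (Real.log m - Real.log (b ^ 2)) := by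
      have := Real.one_sub_inv_le_log_of_pos (x := m / b ^ 2) (by positivity)
      rw [Real.log_div hm0.ne' (by positivity)] at this
      calc m - b ^ 2 = m * (1 - (m / b ^ 2)⁻¹) := by field_simp
        _ ≤ _ := by gcongr
    have h2 : a ^ 2 * (Real.log (a ^ 2) - Real.log (b ^ 2)) - a ^ 2 + b ^ 2 ≤ 9 * (a - b) ^ 2 := by
      rcases ha.eq_or_lt with rfl | ha'
      · nlinarith
      have := Real.log_le_sub_one_of_pos (x := a ^ 2 / b ^ 2) (by positivity)
      rw [Real.log_div (by positivity) (by positivity)] at this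
      calc a ^ 2 * (Real.log (a ^ 2) - Real.log (b ^ 2)) - a ^ 2 + b ^ 2
          ≤ a ^ 2 * (a ^ 2 / b ^ 2 - 1) - a ^ 2 + b ^ 2 := by gcongr
        _ = (a - b) ^ 2 * ((a + b) / b) ^ 2 := by field_simp; ring
        _ ≤ (a - b) ^ 2 * 3 ^ 2 := by
            gcongr
            rw [div_le_iff₀ hb']
            linarith
        _ = _ := by ring
    have h3 : p * (a ^ 2 * (Real.log (a ^ 2) - Real.log (b ^ 2)) - a ^ 2 + b ^ 2)
      ≤ p * (9 * (a - b) ^ 2) := by gcongr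
    have : p * (a - b) ^ 2 * 0.69 ≤ p * (a - b) ^ 2 * L := by gcongr
    have h4 : p * (a ^ 2 * Real.log (a ^ 2)) + (1 - p) * (b ^ 2 * Real.log (b ^ 2)) - m * Real.log m
        = p * (a ^ 2 * (Real.log (a ^ 2) - Real.log (b ^ 2)) - a ^ 2 + b ^ 2)
          + ((m - b ^ 2) - m * (Real.log m - Real.log (b ^ 2))) := by rw [hm]; ring
    nlinarith

/-- Logarithmic Sobolev inequality for product Bernoulli measures. -/
theorem bernoulli_log_sobolev {N : ℕ} {p : Fin N → ℝ}
    (hp : ∀ i, p i ∈ Set.Ioc (0 : ℝ) (1 / 2)) (g : (Fin N → Bool) → ℝ) :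
    bernoulliExp p (fun x => g x ^ 2 * Real.log (g x ^ 2))
        - bernoulliExp p (fun x => g x ^ 2) * Real.log (bernoulliExp p (fun x => g x ^ 2))
      ≤ ∑ i, 14 * (-Real.log (p i)) * p i * bernoulliExp p (fun x => flipDiff i g x ^ 2) := by
  induction N with
  | zero => simp [bernoulliExp_zero_dim]
  | succ N ih =>
    have hp' : ∀ i, Fin.tail p i ∈ Set.Ioc (0 : ℝ) (1 / 2) := fun i => hp i.succ
    obtain ⟨hp0, hp2⟩ := hp 0
    have hq : 0 ≤ 1 - p 0 := by linarith
    set g₁ := headRestrict true g with hg₁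
    set g₀ := headRestrict false g with hg₀
    have e1 : bernoulliExp p (fun x => g x ^ 2 * Real.log (g x ^ 2))
        = p 0 * bernoulliExp (Fin.tail p) (fun x => g₁ x ^ 2 * Real.log (g₁ x ^ 2))
          + (1 - p 0) * bernoulliExp (Fin.tail p) (fun x => g₀ x ^ 2 * Real.log (g₀ x ^ 2)) :=
      bernoulliExp_succ p _
    have e2 : bernoulliExp p (fun x => g x ^ 2)
        = p 0 * bernoulliExp (Fin.tail p) (fun x => g₁ x ^ 2)
          + (1 - p 0) * bernoulliExp (Fin.tail p) (fun x => g₀ x ^ 2) :=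
      bernoulliExp_succ p _
    have ih₁ := mul_le_mul_of_nonneg_left (ih hp' g₁) hp0.le
    have ih₀ := mul_le_mul_of_nonneg_left (ih hp' g₀) hq
    have hmink := sq_sqrt_bernoulliExp_sub_le hp' g₁ g₀
    have ha : 0 ≤ bernoulliExp (Fin.tail p) (fun x => g₁ x ^ 2) :=
      bernoulliExp_nonneg hp' fun _ => sq_nonneg _
    have hb : 0 ≤ bernoulliExp (Fin.tail p) (fun x => g₀ x ^ 2) :=
      bernoulliExp_nonneg hp' fun _ => sq_nonneg _
    have h2 := two_point_log_sobolev (hp 0)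
      (Real.sqrt_nonneg (bernoulliExp (Fin.tail p) (fun x => g₁ x ^ 2)))
      (Real.sqrt_nonneg (bernoulliExp (Fin.tail p) (fun x => g₀ x ^ 2)))
    rw [Real.sq_sqrt ha, Real.sq_sqrt hb] at h2
    have hL : 0 ≤ 14 * (-Real.log (p 0)) * p 0 := by
      have := Real.log_nonpos hp0.le (by linarith)
      have : 0 ≤ -Real.log (p 0) := by linarith
      positivity
    have h3 := h2.trans (mul_le_mul_of_nonneg_left hmink hL)
    rw [Fin.sum_univ_succ,
      bernoulliExp_flipDiff_zero p (φ := fun t => t ^ 2) (fun t => neg_sq t) g]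
    have e3 : ∑ i : Fin N, 14 * (-Real.log (p i.succ)) * p i.succ
          * bernoulliExp p (fun x => flipDiff i.succ g x ^ 2)
        = p 0 * (∑ i, 14 * (-Real.log (Fin.tail p i)) * Fin.tail p i
            * bernoulliExp (Fin.tail p) (fun x => flipDiff i g₁ x ^ 2))
          + (1 - p 0) * ∑ i, 14 * (-Real.log (Fin.tail p i)) * Fin.tail p i
            * bernoulliExp (Fin.tail p) (fun x => flipDiff i g₀ x ^ 2) := by
      rw [Finset.mul_sum, Finset.mul_sum, ← Finset.sum_add_distrib]
      refine Finset.sum_congr rfl fun i _ => ?_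
      rw [bernoulliExp_flipDiff_succ p (fun t => t ^ 2)]
      simp only [Fin.tail]
      ring
    rw [e3, e1, e2]
    linarith

/-- Lower bound on the entropy of `d ^ 2` by the `L²` and `L¹` norms of `d`, in a form that is
linear in the squared norms. -/
theorem bernoulli_entropy_sq_lower_bound {N : ℕ} {p : Fin N → ℝ}
    (hp : ∀ i, p i ∈ Set.Ioc (0 : ℝ) (1 / 2)) (d : (Fin N → Bool) → ℝ) {s : ℝ} (hs : 0 < s) :
    bernoulliExp p (fun x => d x ^ 2) * (1 + Real.log s) - s * bernoulliExp p (fun x => |d x|) ^ 2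
      ≤ bernoulliExp p (fun x => d x ^ 2 * Real.log (d x ^ 2))
        - bernoulliExp p (fun x => d x ^ 2) * Real.log (bernoulliExp p (fun x => d x ^ 2)) := by
  have hA : 0 ≤ bernoulliExp p (fun x => d x ^ 2) := bernoulliExp_nonneg hp fun _ => sq_nonneg _
  rcases hA.eq_or_lt with hA0 | hApos
  · have hz : ∀ x, (∏ i, if x i then p i else 1 - p i) * d x ^ 2 = 0 := fun x =>
      (Finset.sum_eq_zero_iff_of_nonneg
        fun x _ => mul_nonneg (bernoulli_weight_nonneg hp x) (sq_nonneg (d x))).1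
        hA0.symm x (Finset.mem_univ x)
    have h0 : bernoulliExp p (fun x => d x ^ 2 * Real.log (d x ^ 2)) = 0 :=
      Finset.sum_eq_zero fun x _ => by rw [← mul_assoc, hz, zero_mul]
    rw [h0, ← hA0]
    have : 0 ≤ s * bernoulliExp p (fun x => |d x|) ^ 2 := by positivity
    linarith
  · set A := bernoulliExp p (fun x => d x ^ 2) with hAdef
    set B := bernoulliExp p (fun x => |d x|) with hBdef
    have hu : 0 < √A * √s := by positivity
    have hlogu : 2 * Real.log (√A * √s) = Real.log A + Real.log s := by
      rw [Real.log_mul (by positivity) (by positivity), Real.log_sqrt hA, Real.log_sqrt hs.le]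
      ring
    have pointwise (x) : (2 * (1 + Real.log (√A * √s))) * d x ^ 2 + (-2 * (√A * √s)) * |d x|
        ≤ d x ^ 2 * Real.log (d x ^ 2) := by
      rcases eq_or_ne (d x) 0 with h | h
      · simp [h]
      have hd : 0 < |d x| := abs_pos.2 h
      have h1 := Real.one_sub_inv_le_log_of_pos (x := |d x| / (√A * √s)) (by positivity)
      rw [Real.log_div hd.ne' hu.ne'] at h1
      rw [← sq_abs (d x), Real.log_pow]
      have h2 : |d x| ^ 2 * (1 - (|d x| / (√A * √s))⁻¹)
          ≤ |d x| ^ 2 * (Real.log |d x| - Real.log (√A * √s)) := by gcongr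
      have h3 : |d x| ^ 2 * (1 - (|d x| / (√A * √s))⁻¹) = |d x| ^ 2 - √A * √s * |d x| := by
        field_simp
      push_cast
      linarith
    have h := bernoulliExp_mono hp pointwise
    rw [bernoulliExp_add, bernoulliExp_const_mul, bernoulliExp_const_mul, ← hAdef, ← hBdef] at h
    have hsq := sq_nonneg (√A - √s * B)
    rw [sub_sq, mul_pow, Real.sq_sqrt hA, Real.sq_sqrt hs.le] at hsq
    have hmul : 2 * (1 + Real.log (√A * √s)) * A = 2 * A + (Real.log A + Real.log s) * A := by
      rw [← hlogu]; ring
    linarith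

/-- The key inequality: martingale differences of `f` along the coordinates, combined with the
logarithmic Sobolev inequality, in a form linear in the variance. -/
theorem bernoulli_variance_inequality {N : ℕ} {p : Fin N → ℝ}
    (hp : ∀ i, p i ∈ Set.Ioc (0 : ℝ) (1 / 2)) (f : (Fin N → Bool) → ℝ) {s : ℝ} (hs : 0 < s) :
    (bernoulliExp p (fun x => f x ^ 2) - bernoulliExp p f ^ 2) * (1 + Real.log s)
        - s * ∑ i, (2 * p i * bernoulliExp p (fun x => |flipDiff i f x|)) ^ 2
      ≤ ∑ i, 14 * (-Real.log (p i)) * p i * bernoulliExp p (fun x => flipDiff i f x ^ 2) := by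
  induction N with
  | zero => simp [bernoulliExp_zero_dim]
  | succ N ih =>
    have hp' : ∀ i, Fin.tail p i ∈ Set.Ioc (0 : ℝ) (1 / 2) := fun i => hp i.succ
    obtain ⟨hp0, hp2⟩ := hp 0
    have hq : 0 ≤ 1 - p 0 := by linarith
    set f₁ := headRestrict true f with hf₁
    set f₀ := headRestrict false f with hf₀
    let A : (Fin N → Bool) → ℝ := fun y => p 0 * f₁ y + (1 - p 0) * f₀ y
    let d : (Fin (N + 1) → Bool) → ℝ := fun x => f x - A (Fin.tail x)
    have hd₁ : headRestrict true d = fun y => (1 - p 0) * (f₁ y - f₀ y) := by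
      ext y
      simp only [headRestrict, d, A, Fin.tail_cons, f₁, f₀]
      ring
    have hd₀ : headRestrict false d = fun y => (-p 0) * (f₁ y - f₀ y) := by
      ext y
      simp only [headRestrict, d, A, Fin.tail_cons, f₁, f₀]
      ring
    have hent := (bernoulli_entropy_sq_lower_bound hp d hs).trans (bernoulli_log_sobolev hp d)
    have hA := ih hp' A
    have hEA : bernoulliExp (Fin.tail p) A = bernoulliExp p f := by
      rw [bernoulliExp_succ, ← bernoulliExp_const_mul, ← bernoulliExp_const_mul,
        ← bernoulliExp_add]
    -- second moments split orthogonally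
    have hsq : bernoulliExp p (fun x => f x ^ 2)
        = bernoulliExp p (fun x => d x ^ 2) + bernoulliExp (Fin.tail p) (fun y => A y ^ 2) := by
      have e1 : bernoulliExp p (fun x => f x ^ 2)
          = p 0 * bernoulliExp (Fin.tail p) (fun y => f₁ y ^ 2)
            + (1 - p 0) * bernoulliExp (Fin.tail p) (fun y => f₀ y ^ 2) := bernoulliExp_succ p _
      have e2 : bernoulliExp p (fun x => d x ^ 2)
          = p 0 * bernoulliExp (Fin.tail p) (fun y => headRestrict true d y ^ 2)
            + (1 - p 0) * bernoulliExp (Fin.tail p) (fun y => headRestrict false d y ^ 2) :=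
        bernoulliExp_succ p _
      rw [e1, e2, hd₁, hd₀]
      simp only [← bernoulliExp_const_mul, ← bernoulliExp_add]
      congr 1
      ext y
      simp only [A]
      ring
    have henergy (i : Fin N) : bernoulliExp p (fun x => flipDiff i.succ f x ^ 2)
        = bernoulliExp p (fun x => flipDiff i.succ d x ^ 2)
          + bernoulliExp (Fin.tail p) (fun y => flipDiff i A y ^ 2) := by
      rw [bernoulliExp_flipDiff_succ p (fun t => t ^ 2),
        bernoulliExp_flipDiff_succ p (fun t => t ^ 2), hd₁, hd₀]
      simp only [← bernoulliExp_const_mul, ← bernoulliExp_add]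
      congr 1
      ext y
      simp only [A, flipDiff, f₁, f₀]
      ring
    have henergy0 : bernoulliExp p (fun x => flipDiff 0 f x ^ 2)
        = bernoulliExp p (fun x => flipDiff 0 d x ^ 2) := by
      rw [bernoulliExp_flipDiff_zero p (φ := fun t => t ^ 2) (fun t => neg_sq t),
        bernoulliExp_flipDiff_zero p (φ := fun t => t ^ 2) (fun t => neg_sq t), hd₁, hd₀]
      congr 1
      ext y
      ring
    have hL1 : bernoulliExp p (fun x => |d x|)
        ≤ 2 * p 0 * bernoulliExp p (fun x => |flipDiff 0 f x|) := by
      rw [bernoulliExp_flipDiff_zero p (φ := fun t => |t|) (fun t => abs_neg t)]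
      have e : bernoulliExp p (fun x => |d x|)
          = p 0 * bernoulliExp (Fin.tail p) (fun y => |headRestrict true d y|)
            + (1 - p 0) * bernoulliExp (Fin.tail p) (fun y => |headRestrict false d y|) :=
        bernoulliExp_succ p _
      rw [e, hd₁, hd₀]
      simp only [abs_mul, abs_neg, abs_of_nonneg hq, abs_of_pos hp0, bernoulliExp_const_mul]
      have h0 : 0 ≤ bernoulliExp (Fin.tail p) (fun y => |f₁ y - f₀ y|) :=
        bernoulliExp_nonneg hp' fun _ => abs_nonneg _
      have := mul_nonneg (mul_nonneg hp0.le hp0.le) h0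
      nlinarith
    have hL1A (i : Fin N) : bernoulliExp (Fin.tail p) (fun y => |flipDiff i A y|)
        ≤ bernoulliExp p (fun x => |flipDiff i.succ f x|) := by
      rw [bernoulliExp_flipDiff_succ p (fun t => |t|)]
      simp only [← bernoulliExp_const_mul, ← bernoulliExp_add]
      refine bernoulliExp_mono hp' fun y => ?_
      have e : flipDiff i A y = p 0 * flipDiff i f₁ y + (1 - p 0) * flipDiff i f₀ y := by
        simp only [A, flipDiff]
        ring
      rw [e]
      refine (abs_add_le _ _).trans_eq ?_
      rw [abs_mul, abs_mul, abs_of_nonneg hq, abs_of_pos hp0]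
    have hB0 : s * bernoulliExp p (fun x => |d x|) ^ 2
        ≤ s * (2 * p 0 * bernoulliExp p (fun x => |flipDiff 0 f x|)) ^ 2 := by
      have : 0 ≤ bernoulliExp p (fun x => |d x|) := bernoulliExp_nonneg hp fun _ => abs_nonneg _
      gcongr
    have hB : s * ∑ i, (2 * Fin.tail p i
          * bernoulliExp (Fin.tail p) (fun y => |flipDiff i A y|)) ^ 2
        ≤ s * ∑ i : Fin N, (2 * p i.succ
          * bernoulliExp p (fun x => |flipDiff i.succ f x|)) ^ 2 := by
      refine mul_le_mul_of_nonneg_left (Finset.sum_le_sum fun i _ => ?_) hs.le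
      have h0 : 0 ≤ bernoulliExp (Fin.tail p) (fun y => |flipDiff i A y|) :=
        bernoulliExp_nonneg hp' fun _ => abs_nonneg _
      have hi : 0 < p i.succ := (hp i.succ).1
      change (2 * p i.succ * _) ^ 2 ≤ _
      gcongr
      exact hL1A i
    have hR : ∑ i : Fin N, 14 * (-Real.log (p i.succ)) * p i.succ
          * bernoulliExp p (fun x => flipDiff i.succ f x ^ 2)
        = ∑ i : Fin N, 14 * (-Real.log (p i.succ)) * p i.succ
            * bernoulliExp p (fun x => flipDiff i.succ d x ^ 2)
          + ∑ i, 14 * (-Real.log (Fin.tail p i)) * Fin.tail p i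
            * bernoulliExp (Fin.tail p) (fun y => flipDiff i A y ^ 2) := by
      rw [← Finset.sum_add_distrib]
      refine Finset.sum_congr rfl fun i _ => ?_
      rw [henergy, mul_add]
      rfl
    rw [Fin.sum_univ_succ] at hent ⊢
    rw [Fin.sum_univ_succ, hR, hsq, henergy0]
    rw [hEA] at hA
    linarith


/-- **Inhomogeneous Talagrand inequality.**
There exists a universal constant `C > 0` such that for every `N ≥ 1`, every
`p₁,…,p_N ∈ (0,1/2]` and every non-constant Boolean function `f : {0,1}^N → {0,1}`,
`∑ i, pᵢ |log pᵢ| Infᵢ(f) ≥ C ⋅ Var(f) ⋅ log (1 / maxᵢ pᵢ Infᵢ(f))`,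
where influences and variance are with respect to the product Bernoulli measure. -/
theorem stmt_0 :
    ∃ C : ℝ, 0 < C ∧
      ∀ (N : ℕ) (hN : 1 ≤ N) (p : Fin N → ℝ),
        (∀ i, p i ∈ Set.Ioc (0 : ℝ) (1 / 2)) →
        ∀ f : (Fin N → Bool) → Bool, (∃ x y, f x ≠ f y) →
        -- weight of a configuration under the product Bernoulli measure
        let w : (Fin N → Bool) → ℝ := fun x => ∏ i, if x i then p i else 1 - p i
        -- influence of coordinate `i`: probability that flipping bit `i` changes `f`
        let Inf : Fin N → ℝ := fun i =>
          ∑ x : Fin N → Bool, if f (Function.update x i (!x i)) ≠ f x then w x else 0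
        -- expectation and variance of the indicator of `f`
        let E : ℝ := ∑ x : Fin N → Bool, w x * (if f x then 1 else 0)
        let V : ℝ := (∑ x : Fin N → Bool, w x * (if f x then 1 else 0) ^ 2) - E ^ 2
        let M : ℝ := Finset.univ.sup' ⟨⟨0, hN⟩, Finset.mem_univ _⟩ (fun i => p i * Inf i)
        C * V * Real.log (1 / M) ≤ ∑ i, p i * |Real.log (p i)| * Inf i := by
  refine ⟨1 / 40, by norm_num, fun N hN p hp f hf => ?_⟩
  intro w Inf E V M
  let g : (Fin N → Bool) → ℝ := fun x => if f x then 1 else 0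
  have hflip (i : Fin N) (x : Fin N → Bool) :
      |flipDiff i g x| = if f (Function.update x i (!x i)) ≠ f x then 1 else 0 := by
    simp only [flipDiff, g]
    cases f (Function.update x i (!x i)) <;> cases f x <;> simp
  have hflipsq (i : Fin N) (x : Fin N → Bool) : flipDiff i g x ^ 2 = |flipDiff i g x| := by
    rw [← sq_abs, hflip]
    split_ifs <;> norm_num
  have hInf1 (i : Fin N) : bernoulliExp p (fun x => |flipDiff i g x|) = Inf i := by
    simp only [hflip, bernoulliExp, mul_ite, mul_one, mul_zero]
    rfl
  have hInf2 (i : Fin N) : bernoulliExp p (fun x => flipDiff i g x ^ 2) = Inf i := by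
    simp only [hflipsq, hInf1]
  have hInf0 (i : Fin N) : 0 ≤ Inf i := by
    rw [← hInf1]
    exact bernoulliExp_nonneg hp fun _ => abs_nonneg _
  have hw (x : Fin N → Bool) : 0 < w x := by
    refine Finset.prod_pos fun i _ => ?_
    obtain ⟨h0, h2⟩ := hp i
    split_ifs <;> linarith
  have hle (i : Fin N) : p i * Inf i ≤ M :=
    Finset.le_sup' (fun i => p i * Inf i) (Finset.mem_univ i)
  have hVnonneg : 0 ≤ V := by
    have h := sq_bernoulliExp_mul_le hp g (fun _ => 1)
    simp only [mul_one, one_pow, bernoulliExp_one] at h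
    exact sub_nonneg.2 h
  have hR0 : 0 ≤ ∑ i, p i * |Real.log (p i)| * Inf i :=
    Finset.sum_nonneg fun i _ => mul_nonneg (mul_nonneg (hp i).1.le (abs_nonneg _)) (hInf0 i)
  have hM0 : 0 ≤ M := (mul_nonneg (hp ⟨0, hN⟩).1.le (hInf0 _)).trans (hle ⟨0, hN⟩)
  rcases hM0.eq_or_lt with hM | hM
  · rw [← hM]
    simpa using hR0
  have hInfle (i : Fin N) : Inf i ≤ 1 := by
    rw [← hInf1, ← bernoulliExp_one p]
    refine bernoulliExp_mono hp fun x => ?_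
    rw [hflip]
    split_ifs <;> norm_num
  have hM1 : M ≤ 1 := Finset.sup'_le _ _ fun i _ => by
    have := hp i
    exact mul_le_one₀ (this.2.trans (by norm_num)) (hInf0 i) (hInfle i)
  have hsM : 0 < √M := Real.sqrt_pos.2 hM
  have hkey := bernoulli_variance_inequality hp g (s := (√M)⁻¹) (by positivity)
  simp only [hInf1, hInf2] at hkey
  have hVeq : bernoulliExp p (fun x => g x ^ 2) - bernoulliExp p g ^ 2 = V := rfl
  have hlog (i : Fin N) : 0.69 ≤ -Real.log (p i) ∧ |Real.log (p i)| = -Real.log (p i) := by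
    obtain ⟨h0, h2⟩ := hp i
    have h1 := Real.log_le_log h0 h2
    rw [one_div, Real.log_inv] at h1
    have := Real.log_two_gt_d9
    exact ⟨by linarith, abs_of_nonpos (by linarith)⟩
  have hsum : (√M)⁻¹ * ∑ i, (2 * p i * Inf i) ^ 2
      ≤ 6 * ∑ i, p i * |Real.log (p i)| * Inf i := by
    rw [Finset.mul_sum, Finset.mul_sum]
    refine Finset.sum_le_sum fun i _ => ?_
    obtain ⟨hl, habs⟩ := hlog i
    have ht : 0 ≤ p i * Inf i := mul_nonneg (hp i).1.le (hInf0 i)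
    have h1 : (√M)⁻¹ * (p i * Inf i) ≤ 1 := by
      rw [inv_mul_le_one₀ hsM]
      refine (hle i).trans (Real.le_sqrt_of_sq_le ?_)
      nlinarith
    have h2 := mul_le_mul_of_nonneg_right h1 ht
    have h3 := mul_le_mul_of_nonneg_left hl ht
    rw [habs]
    linarith
  have hRHS : ∑ i, 14 * (-Real.log (p i)) * p i * Inf i
      = 14 * ∑ i, p i * |Real.log (p i)| * Inf i := by
    rw [Finset.mul_sum]
    refine Finset.sum_congr rfl fun i _ => ?_
    rw [(hlog i).2]
    ring
  rw [hVeq, hRHS, Real.log_inv, Real.log_sqrt hM.le] at hkey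
  rw [one_div M, Real.log_inv]
  linarith
end

section
/- There exists a universal constant C > 0 such that for every integer N ≥ 1, every p ∈ (0,1), and every non-constant Boolean function f : {0,1}^N → {0,1}, one has ∑_{i=1}^N Inf_i(f) ≥ ( C / log( 2 / (p(1−p)) ) ) · Var(f) · log( 1 / max_{1 ≤ i ≤ N} Inf_i(f) ), where the influences and variance are taken with respect to the homogeneous product Bernoulli measure Ber(p)^{⊗N}. -/
/-- Expectation of `g` under the product Bernoulli measure `Ber(p)^{⊗n}` on the cube. -/
def cubeExp (p : ℝ) {n : ℕ} (g : (Fin n → Bool) → ℝ) : ℝ :=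
  ∑ x : Fin n → Bool, (∏ i, if x i then p else 1 - p) * g x

/-- Discrete derivative of `g` in direction `i`. -/
def cubeDiff {n : ℕ} (i : Fin n) (g : (Fin n → Bool) → ℝ) (x : Fin n → Bool) : ℝ :=
  g (Function.update x i (!x i)) - g x

/-- Restriction of `g` to the face where the first coordinate equals `b`. -/
def cubeFace {n : ℕ} (b : Bool) (g : (Fin (n + 1) → Bool) → ℝ) (y : Fin n → Bool) : ℝ :=
  g (Fin.cons b y)

/-- Dirichlet energy of `g`: the sum of the mean squares of its discrete derivatives. -/
def cubeEnergy (p : ℝ) {n : ℕ} (g : (Fin n → Bool) → ℝ) : ℝ :=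
  ∑ i, cubeExp p fun x => cubeDiff i g x ^ 2

section CubeExp

variable {p : ℝ} {n : ℕ}

lemma cubeExp_zero (g : (Fin 0 → Bool) → ℝ) : cubeExp p g = g default := by
  rw [cubeExp, Fintype.sum_unique, Finset.univ_eq_empty, Finset.prod_empty, one_mul]
  exact congrArg g (Subsingleton.elim _ _)

lemma cubeExp_succ (g : (Fin (n + 1) → Bool) → ℝ) :
    cubeExp p g = p * cubeExp p (cubeFace true g) + (1 - p) * cubeExp p (cubeFace false g) := by
  unfold cubeExp cubeFace
  rw [← (Fin.consEquiv fun _ : Fin (n + 1) => Bool).sum_comp, Fintype.sum_prod_type]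
  simp [Fin.consEquiv, Fin.prod_univ_succ, Finset.mul_sum, mul_assoc]

lemma cubeExp_add (g h : (Fin n → Bool) → ℝ) :
    cubeExp p (fun x => g x + h x) = cubeExp p g + cubeExp p h := by
  simp [cubeExp, mul_add, Finset.sum_add_distrib]

lemma cubeExp_const_mul (c : ℝ) (g : (Fin n → Bool) → ℝ) :
    cubeExp p (fun x => c * g x) = c * cubeExp p g := by
  simp only [cubeExp, Finset.mul_sum]
  exact Finset.sum_congr rfl fun x _ => by ring

lemma weight_nonneg (hp : p ∈ Set.Icc (0 : ℝ) 1) (x : Fin n → Bool) :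
    0 ≤ ∏ i, if x i then p else 1 - p :=
  Finset.prod_nonneg fun i _ => by split_ifs <;> linarith [hp.1, hp.2]

lemma cubeExp_mono (hp : p ∈ Set.Icc (0 : ℝ) 1) {g h : (Fin n → Bool) → ℝ}
    (hgh : ∀ x, g x ≤ h x) : cubeExp p g ≤ cubeExp p h :=
  Finset.sum_le_sum fun x _ => mul_le_mul_of_nonneg_left (hgh x) (weight_nonneg hp x)

lemma cubeExp_nonneg (hp : p ∈ Set.Icc (0 : ℝ) 1) {g : (Fin n → Bool) → ℝ}
    (hg : ∀ x, 0 ≤ g x) : 0 ≤ cubeExp p g :=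
  Finset.sum_nonneg fun x _ => mul_nonneg (weight_nonneg hp x) (hg x)

lemma cubeExp_const (c : ℝ) : cubeExp p (fun _ : Fin n → Bool => c) = c := by
  induction n with
  | zero => rw [cubeExp_zero]
  | succ n ih =>
    rw [cubeExp_succ]
    change p * cubeExp p (fun _ : Fin n → Bool => c)
      + (1 - p) * cubeExp p (fun _ : Fin n → Bool => c) = c
    rw [ih]
    ring

lemma sq_cubeExp_le (hp : p ∈ Set.Icc (0 : ℝ) 1) (g : (Fin n → Bool) → ℝ) :
    cubeExp p g ^ 2 ≤ cubeExp p fun x => g x ^ 2 := by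
  have h := cubeExp_mono hp (g := fun x => 2 * cubeExp p g * g x + -cubeExp p g ^ 2)
    (h := fun x => g x ^ 2) fun x => by nlinarith [sq_nonneg (g x - cubeExp p g)]
  rw [cubeExp_add, cubeExp_const_mul, cubeExp_const] at h
  linarith

lemma cubeExp_mul_le_sqrt (hp : p ∈ Set.Icc (0 : ℝ) 1) (g h : (Fin n → Bool) → ℝ) :
    cubeExp p (fun x => g x * h x) ≤
      √(cubeExp p fun x => g x ^ 2) * √(cubeExp p fun x => h x ^ 2) := by
  have key := Real.sum_mul_le_sqrt_mul_sqrt Finset.univ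
    (fun x : Fin n → Bool => √(∏ i, if x i then p else 1 - p) * g x)
    (fun x => √(∏ i, if x i then p else 1 - p) * h x)
  simp only [mul_pow, Real.sq_sqrt (weight_nonneg hp _)] at key
  refine le_trans (le_of_eq (Finset.sum_congr rfl fun x _ => ?_)) key
  rw [mul_mul_mul_comm, Real.mul_self_sqrt (weight_nonneg hp x)]

lemma cubeDiff_zero_cons (g : (Fin (n + 1) → Bool) → ℝ) (b : Bool) (y : Fin n → Bool) :
    cubeDiff 0 g (Fin.cons b y) = cubeFace (!b) g y - cubeFace b g y := by
  simp [cubeDiff, cubeFace]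

lemma cubeDiff_succ_cons (g : (Fin (n + 1) → Bool) → ℝ) (i : Fin n) (b : Bool)
    (y : Fin n → Bool) :
    cubeDiff i.succ g (Fin.cons b y) = cubeDiff i (cubeFace b g) y := by
  simp [cubeDiff, cubeFace, Fin.cons_update]

lemma cubeEnergy_nonneg (hp : p ∈ Set.Icc (0 : ℝ) 1) (g : (Fin n → Bool) → ℝ) :
    0 ≤ cubeEnergy p g :=
  Finset.sum_nonneg fun _ _ => cubeExp_nonneg hp fun _ => sq_nonneg _

lemma cubeEnergy_succ (g : (Fin (n + 1) → Bool) → ℝ) :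
    cubeEnergy p g = cubeExp p (fun y => (cubeFace true g y - cubeFace false g y) ^ 2)
      + (p * cubeEnergy p (cubeFace true g) + (1 - p) * cubeEnergy p (cubeFace false g)) := by
  unfold cubeEnergy
  rw [Fin.sum_univ_succ, Finset.mul_sum, Finset.mul_sum, ← Finset.sum_add_distrib]
  congr 1
  · rw [cubeExp_succ]
    have h1 : cubeFace true (fun x => cubeDiff 0 g x ^ 2)
        = fun y => (cubeFace true g y - cubeFace false g y) ^ 2 := by
      funext y
      change cubeDiff 0 g (Fin.cons true y) ^ 2 = _
      rw [cubeDiff_zero_cons, Bool.not_true]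
      ring
    have h0 : cubeFace false (fun x => cubeDiff 0 g x ^ 2)
        = fun y => (cubeFace true g y - cubeFace false g y) ^ 2 := by
      funext y
      change cubeDiff 0 g (Fin.cons false y) ^ 2 = _
      rw [cubeDiff_zero_cons, Bool.not_false]
    rw [h1, h0]
    ring
  · refine Finset.sum_congr rfl fun i _ => ?_
    rw [cubeExp_succ]
    have h : ∀ b, cubeFace b (fun x => cubeDiff i.succ g x ^ 2)
        = fun y => cubeDiff i (cubeFace b g) y ^ 2 := fun b => by
      funext y
      change cubeDiff i.succ g (Fin.cons b y) ^ 2 = _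
      rw [cubeDiff_succ_cons]
    rw [h, h]

lemma cubeExp_abs_diff_zero (g : (Fin (n + 1) → Bool) → ℝ) :
    cubeExp p (fun x => |cubeDiff 0 g x|)
      = cubeExp p fun y => |cubeFace true g y - cubeFace false g y| := by
  rw [cubeExp_succ]
  have h1 : cubeFace true (fun x => |cubeDiff 0 g x|)
      = fun y => |cubeFace true g y - cubeFace false g y| := by
    funext y
    change |cubeDiff 0 g (Fin.cons true y)| = _
    rw [cubeDiff_zero_cons, Bool.not_true, abs_sub_comm]
  have h0 : cubeFace false (fun x => |cubeDiff 0 g x|)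
      = fun y => |cubeFace true g y - cubeFace false g y| := by
    funext y
    change |cubeDiff 0 g (Fin.cons false y)| = _
    rw [cubeDiff_zero_cons, Bool.not_false]
  rw [h1, h0]
  ring

lemma cubeExp_abs_diff_succ (g : (Fin (n + 1) → Bool) → ℝ) (i : Fin n) :
    cubeExp p (fun x => |cubeDiff i.succ g x|)
      = p * cubeExp p (fun y => |cubeDiff i (cubeFace true g) y|)
        + (1 - p) * cubeExp p (fun y => |cubeDiff i (cubeFace false g) y|) := by
  rw [cubeExp_succ]
  have h : ∀ b, cubeFace b (fun x => |cubeDiff i.succ g x|)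
      = fun y => |cubeDiff i (cubeFace b g) y| := fun b => by
    funext y
    change |cubeDiff i.succ g (Fin.cons b y)| = _
    rw [cubeDiff_succ_cons]
  rw [h, h]

/-- Averaging two functions and taking their difference splits the energy. -/
lemma cubeEnergy_convexComb (g h : (Fin n → Bool) → ℝ) :
    cubeEnergy p (fun y => p * g y + (1 - p) * h y)
        + p * (1 - p) * cubeEnergy p (fun y => g y - h y)
      = p * cubeEnergy p g + (1 - p) * cubeEnergy p h := by
  simp only [cubeEnergy, Finset.mul_sum, ← Finset.sum_add_distrib]
  refine Finset.sum_congr rfl fun i _ => ?_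
  simp only [← cubeExp_const_mul, ← cubeExp_add]
  congr 1
  funext x
  simp only [cubeDiff]
  ring

lemma cubeEnergy_const_mul (c : ℝ) (g : (Fin n → Bool) → ℝ) :
    cubeEnergy p (fun y => c * g y) = c ^ 2 * cubeEnergy p g := by
  simp only [cubeEnergy, Finset.mul_sum, ← cubeExp_const_mul]
  refine Finset.sum_congr rfl fun i _ => ?_
  congr 1
  funext x
  simp only [cubeDiff]
  ring

/-- Two-point logarithmic Sobolev inequality. -/
lemma twoPoint_logSobolev (hp : p ∈ Set.Icc (0 : ℝ) 1) (a b : ℝ) :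
    p * (a ^ 2 * Real.log (a ^ 2)) + (1 - p) * (b ^ 2 * Real.log (b ^ 2))
        - (p * a ^ 2 + (1 - p) * b ^ 2) * Real.log (p * a ^ 2 + (1 - p) * b ^ 2)
      ≤ (a - b) ^ 2 := by
  obtain ⟨hp0, hp1⟩ := hp
  have hq0 : 0 ≤ 1 - p := by linarith
  set m := p * a ^ 2 + (1 - p) * b ^ 2 with hm
  have hm0 : 0 ≤ m := by positivity
  rcases hm0.eq_or_lt with hm0 | hm0
  · have h1 : p * a ^ 2 = 0 := by
      nlinarith [mul_nonneg hp0 (sq_nonneg a), mul_nonneg hq0 (sq_nonneg b)]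
    have h2 : (1 - p) * b ^ 2 = 0 := by linarith
    rw [← mul_assoc, ← mul_assoc, h1, h2, ← hm0]
    simpa using sq_nonneg (a - b)
  have key : ∀ t : ℝ, 0 ≤ t → t * Real.log t ≤ t * Real.log m + t * (t / m - 1) := by
    intro t ht
    rcases ht.eq_or_lt with rfl | ht
    · simp
    have := Real.log_le_sub_one_of_pos (div_pos ht hm0)
    rw [Real.log_div ht.ne' hm0.ne'] at this
    nlinarith
  have h1 := mul_le_mul_of_nonneg_left (key (a ^ 2) (sq_nonneg a)) hp0
  have h2 := mul_le_mul_of_nonneg_left (key (b ^ 2) (sq_nonneg b)) hq0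
  have h3 : p * (a ^ 2 * (a ^ 2 / m - 1)) + (1 - p) * (b ^ 2 * (b ^ 2 / m - 1))
      ≤ (a - b) ^ 2 := by
    have h4 : p * (a ^ 2 * (a ^ 2 / m - 1)) + (1 - p) * (b ^ 2 * (b ^ 2 / m - 1))
        = p * (1 - p) * (a + b) ^ 2 * (a - b) ^ 2 / m := by
      field_simp
      rw [hm]
      ring
    rw [h4, div_le_iff₀ hm0, mul_comm ((a - b) ^ 2) m]
    refine mul_le_mul_of_nonneg_right ?_ (sq_nonneg _)
    rw [hm]
    nlinarith [sq_nonneg (p * a - (1 - p) * b)]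
  have h5 : m * Real.log m = p * (a ^ 2 * Real.log m) + (1 - p) * (b ^ 2 * Real.log m) := by
    rw [hm]
    ring
  linarith

/-- Logarithmic Sobolev inequality for the biased cube. -/
lemma cube_logSobolev (hp : p ∈ Set.Icc (0 : ℝ) 1) (g : (Fin n → Bool) → ℝ) :
    cubeExp p (fun x => g x ^ 2 * Real.log (g x ^ 2))
        - cubeExp p (fun x => g x ^ 2) * Real.log (cubeExp p fun x => g x ^ 2)
      ≤ cubeEnergy p g := by
  induction n with
  | zero => simp [cubeExp_zero, cubeEnergy]
  | succ n ih =>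
    have ih1 := mul_le_mul_of_nonneg_left (ih (cubeFace true g)) hp.1
    have ih0 := mul_le_mul_of_nonneg_left (ih (cubeFace false g)) (sub_nonneg.2 hp.2)
    rw [cubeEnergy_succ, cubeExp_succ fun x => g x ^ 2 * Real.log (g x ^ 2),
      cubeExp_succ fun x => g x ^ 2]
    change p * cubeExp p (fun y => cubeFace true g y ^ 2 * Real.log (cubeFace true g y ^ 2))
        + (1 - p) * cubeExp p (fun y => cubeFace false g y ^ 2 * Real.log (cubeFace false g y ^ 2))
        - (p * cubeExp p (fun y => cubeFace true g y ^ 2)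
            + (1 - p) * cubeExp p (fun y => cubeFace false g y ^ 2))
          * Real.log (p * cubeExp p (fun y => cubeFace true g y ^ 2)
            + (1 - p) * cubeExp p (fun y => cubeFace false g y ^ 2)) ≤ _
    have hA0 : 0 ≤ cubeExp p (fun y => cubeFace true g y ^ 2) :=
      cubeExp_nonneg hp fun _ => sq_nonneg _
    have hB0 : 0 ≤ cubeExp p (fun y => cubeFace false g y ^ 2) :=
      cubeExp_nonneg hp fun _ => sq_nonneg _
    have two := twoPoint_logSobolev hp
      (√(cubeExp p fun y => cubeFace true g y ^ 2)) (√(cubeExp p fun y => cubeFace false g y ^ 2))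
    have cs := cubeExp_mul_le_sqrt hp (cubeFace true g) (cubeFace false g)
    have expand : cubeExp p (fun y => (cubeFace true g y - cubeFace false g y) ^ 2)
        = cubeExp p (fun y => cubeFace true g y ^ 2) + cubeExp p (fun y => cubeFace false g y ^ 2)
          + (-2) * cubeExp p (fun y => cubeFace true g y * cubeFace false g y) := by
      simp only [← cubeExp_const_mul, ← cubeExp_add]
      congr 1
      funext y
      ring
    rw [sub_sq] at two
    rw [Real.sq_sqrt hA0, Real.sq_sqrt hB0] at two
    linarith

/-- A linearised comparison of the second and first moments of `g` with its energy. -/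
lemma mul_cubeExp_sq_le (hp : p ∈ Set.Icc (0 : ℝ) 1) (g : (Fin n → Bool) → ℝ) (l : ℝ) :
    l * cubeExp p (fun x => g x ^ 2)
      ≤ cubeEnergy p g + Real.exp (l - 1) * cubeExp p (fun x => |g x|) ^ 2 := by
  have hls := cube_logSobolev hp g
  set m := cubeExp p fun x => g x ^ 2
  set a := cubeExp p fun x => |g x|
  have hm0 : 0 ≤ m := cubeExp_nonneg hp fun _ => sq_nonneg _
  rcases hm0.eq_or_lt with hm0 | hm0
  · rw [← hm0, mul_zero]
    have := cubeEnergy_nonneg hp g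
    positivity
  set c := √m * Real.exp ((l - 1) / 2) with hc
  have hc0 : 0 < c := by positivity
  have hlog : 2 * Real.log c = Real.log m + (l - 1) := by
    rw [hc, Real.log_mul (by positivity) (by positivity), Real.log_exp, Real.log_sqrt hm0.le]
    ring
  have hc2 : c ^ 2 = m * Real.exp (l - 1) := by
    rw [hc, mul_pow, Real.sq_sqrt hm0.le, ← Real.exp_nat_mul]
    congr 2
    push_cast
    ring
  have pt : ∀ x, (2 * Real.log c + 2) * g x ^ 2 + (-2 * c) * |g x|
      ≤ g x ^ 2 * Real.log (g x ^ 2) := by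
    intro x
    rw [← sq_abs]
    rcases (abs_nonneg (g x)).eq_or_lt with h | h
    · rw [← h]
      simp
    have h1 := Real.log_le_sub_one_of_pos (div_pos hc0 h)
    rw [Real.log_div hc0.ne' h.ne'] at h1
    have h2 := mul_le_mul_of_nonneg_left h1 (sq_nonneg |g x|)
    have h3 : |g x| ^ 2 * (c / |g x| - 1) = c * |g x| - |g x| ^ 2 := by
      field_simp
    rw [Real.log_pow]
    push_cast
    linarith
  have h := cubeExp_mono hp pt
  rw [cubeExp_add, cubeExp_const_mul, cubeExp_const_mul] at h
  change (2 * Real.log c + 2) * m + (-2 * c) * a ≤ _ at h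
  have amgm : 2 * c * a ≤ m + Real.exp (l - 1) * a ^ 2 := by
    have : m * (2 * c * a) ≤ m * (m + Real.exp (l - 1) * a ^ 2) := by
      nlinarith [sq_nonneg (m - c * a)]
    exact le_of_mul_le_mul_left this hm0
  rw [hlog] at h
  linarith

/-- A linearised form of Talagrand's inequality for real-valued functions on the biased cube. -/
lemma mul_cubeVar_le (hp : p ∈ Set.Icc (0 : ℝ) 1) (f : (Fin n → Bool) → ℝ) (l : ℝ) :
    l * (cubeExp p (fun x => f x ^ 2) - cubeExp p f ^ 2)
      ≤ cubeEnergy p f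
        + Real.exp (l - 1) * ∑ i, cubeExp p (fun x => |cubeDiff i f x|) ^ 2 := by
  obtain ⟨hp0, hp1⟩ := hp
  have hq0 : 0 ≤ 1 - p := by linarith
  induction n with
  | zero => simp [cubeExp_zero, cubeEnergy]
  | succ n ih =>
    set f₁ := cubeFace true f
    set f₀ := cubeFace false f
    have ihm := ih fun y => p * f₁ y + (1 - p) * f₀ y
    have hinc := mul_cubeExp_sq_le ⟨hp0, hp1⟩
      (fun x => f x - (p * f₁ (Fin.tail x) + (1 - p) * f₀ (Fin.tail x))) l
    set g : (Fin (n + 1) → Bool) → ℝ :=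
      fun x => f x - (p * f₁ (Fin.tail x) + (1 - p) * f₀ (Fin.tail x))
    have g1 : cubeFace true g = fun y => (1 - p) * (f₁ y - f₀ y) := by
      funext y
      simp only [cubeFace, g, Fin.tail_cons, f₁, f₀]
      ring
    have g0 : cubeFace false g = fun y => (-p) * (f₁ y - f₀ y) := by
      funext y
      simp only [cubeFace, g, Fin.tail_cons, f₁, f₀]
      ring
    have hsq : cubeExp p (fun x => g x ^ 2)
        = p * (1 - p) * cubeExp p (fun y => (f₁ y - f₀ y) ^ 2) := by
      rw [cubeExp_succ]
      change p * cubeExp p (fun y => cubeFace true g y ^ 2)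
        + (1 - p) * cubeExp p (fun y => cubeFace false g y ^ 2) = _
      simp only [g1, g0, mul_pow, cubeExp_const_mul]
      ring
    have habs : cubeExp p (fun x => |g x|)
        = 2 * (p * (1 - p)) * cubeExp p (fun y => |f₁ y - f₀ y|) := by
      rw [cubeExp_succ]
      change p * cubeExp p (fun y => |cubeFace true g y|)
        + (1 - p) * cubeExp p (fun y => |cubeFace false g y|) = _
      simp only [g1, g0, abs_mul, cubeExp_const_mul, abs_neg, abs_of_nonneg hp0,
        abs_of_nonneg hq0]
      ring
    have hen : cubeEnergy p g = cubeExp p (fun y => (f₁ y - f₀ y) ^ 2)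
        + p * (1 - p) * cubeEnergy p (fun y => f₁ y - f₀ y) := by
      rw [cubeEnergy_succ, g1, g0, cubeEnergy_const_mul, cubeEnergy_const_mul]
      have : (fun y => ((1 - p) * (f₁ y - f₀ y) - -p * (f₁ y - f₀ y)) ^ 2)
          = fun y => (f₁ y - f₀ y) ^ 2 := by
        funext y
        ring
      rw [this]
      ring
    have hsplit := cubeEnergy_convexComb (p := p) f₁ f₀
    have hD0 : 0 ≤ cubeExp p (fun y => |f₁ y - f₀ y|) :=
      cubeExp_nonneg ⟨hp0, hp1⟩ fun _ => abs_nonneg _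
    have habs_le : cubeExp p (fun x => |g x|) ^ 2 ≤ cubeExp p (fun y => |f₁ y - f₀ y|) ^ 2 := by
      rw [habs]
      refine pow_le_pow_left₀ (by positivity) (mul_le_of_le_one_left hD0 ?_) 2
      nlinarith [sq_nonneg (2 * p - 1)]
    have hinf : ∀ i : Fin n,
        cubeExp p (fun y => |cubeDiff i (fun y => p * f₁ y + (1 - p) * f₀ y) y|) ^ 2
          ≤ cubeExp p (fun x => |cubeDiff i.succ f x|) ^ 2 := by
      intro i
      refine pow_le_pow_left₀ (cubeExp_nonneg ⟨hp0, hp1⟩ fun _ => abs_nonneg _) ?_ 2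
      rw [cubeExp_abs_diff_succ, ← cubeExp_const_mul, ← cubeExp_const_mul, ← cubeExp_add]
      refine cubeExp_mono ⟨hp0, hp1⟩ fun y => ?_
      have h : cubeDiff i (fun y => p * f₁ y + (1 - p) * f₀ y) y
          = p * cubeDiff i f₁ y + (1 - p) * cubeDiff i f₀ y := by
        simp only [cubeDiff]
        ring
      rw [h]
      refine (abs_add_le _ _).trans (le_of_eq ?_)
      rw [abs_mul, abs_mul, abs_of_nonneg hp0, abs_of_nonneg hq0]
    have hvar : cubeExp p (fun x => f x ^ 2) - cubeExp p f ^ 2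
        = (cubeExp p (fun y => (p * f₁ y + (1 - p) * f₀ y) ^ 2)
            - cubeExp p (fun y => p * f₁ y + (1 - p) * f₀ y) ^ 2)
          + p * (1 - p) * cubeExp p (fun y => (f₁ y - f₀ y) ^ 2) := by
      have hmean : cubeExp p f = cubeExp p (fun y => p * f₁ y + (1 - p) * f₀ y) := by
        rw [cubeExp_succ, cubeExp_add, cubeExp_const_mul, cubeExp_const_mul]
      have hsecond : cubeExp p (fun x => f x ^ 2)
          = cubeExp p (fun y => (p * f₁ y + (1 - p) * f₀ y) ^ 2)
            + p * (1 - p) * cubeExp p (fun y => (f₁ y - f₀ y) ^ 2) := by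
        rw [cubeExp_succ]
        change p * cubeExp p (fun y => f₁ y ^ 2) + (1 - p) * cubeExp p (fun y => f₀ y ^ 2) = _
        simp only [← cubeExp_const_mul, ← cubeExp_add]
        congr 1
        funext y
        ring
      rw [hmean, hsecond]
      ring
    have hsum := Finset.sum_le_sum fun i (_ : i ∈ Finset.univ) => hinf i
    have hsum' := mul_le_mul_of_nonneg_left (add_le_add habs_le hsum) (Real.exp_pos (l - 1)).le
    rw [hvar, cubeEnergy_succ, Fin.sum_univ_succ, cubeExp_abs_diff_zero]
    rw [hsq, hen] at hinc
    linarith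

end CubeExp

/-- **Talagrand's inequality** (homogeneous version).
There exists a universal constant `C > 0` such that for every `N ≥ 1`, every `p ∈ (0,1)`
and every non-constant Boolean function `f : {0,1}^N → {0,1}`,
`∑ i, Infᵢ(f) ≥ (C / log (2 / (p(1-p)))) ⋅ Var(f) ⋅ log (1 / maxᵢ Infᵢ(f))`,
where influences and variance are with respect to `Ber(p)^{⊗N}`. -/
theorem stmt_1 :
    ∃ C : ℝ, 0 < C ∧
      ∀ (N : ℕ) (hN : 1 ≤ N) (p : ℝ), p ∈ Set.Ioo (0 : ℝ) 1 →
        ∀ f : (Fin N → Bool) → Bool, (∃ x y, f x ≠ f y) →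
        -- weight of a configuration under the homogeneous product Bernoulli measure
        let w : (Fin N → Bool) → ℝ := fun x => ∏ i, if x i then p else 1 - p
        -- influence of coordinate `i`: probability that flipping bit `i` changes `f`
        let Inf : Fin N → ℝ := fun i =>
          ∑ x : Fin N → Bool, if f (Function.update x i (!x i)) ≠ f x then w x else 0
        -- expectation and variance of the indicator of `f`
        let E : ℝ := ∑ x : Fin N → Bool, w x * (if f x then 1 else 0)
        let V : ℝ := (∑ x : Fin N → Bool, w x * (if f x then 1 else 0) ^ 2) - E ^ 2
        let M : ℝ := Finset.univ.sup' ⟨⟨0, hN⟩, Finset.mem_univ _⟩ (fun i => Inf i)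
        C / Real.log (2 / (p * (1 - p))) * V * Real.log (1 / M) ≤ ∑ i, Inf i := by
  refine ⟨1 / 2, by norm_num, fun N hN p hp f _ => ?_⟩
  intro w Inf E V M
  have hp' : p ∈ Set.Icc (0 : ℝ) 1 := Set.Ioo_subset_Icc_self hp
  set F : (Fin N → Bool) → ℝ := fun x => if f x then 1 else 0 with hF
  have hdiff : ∀ i x, |cubeDiff i F x|
      = if f (Function.update x i (!x i)) ≠ f x then 1 else 0 := by
    intro i x
    simp only [cubeDiff, hF]
    cases f (Function.update x i (!x i)) <;> cases f x <;> simp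
  have hInf : ∀ i, cubeExp p (fun x => |cubeDiff i F x|) = Inf i := by
    intro i
    simp only [hdiff, cubeExp, Inf, w, mul_ite, mul_one, mul_zero]
  have hInf0 : ∀ i, 0 ≤ Inf i := fun i => by
    rw [← hInf i]
    exact cubeExp_nonneg hp' fun _ => abs_nonneg _
  have hEnergy : cubeEnergy p F = ∑ i, Inf i := by
    refine Finset.sum_congr rfl fun i _ => ?_
    rw [← hInf i]
    congr 1
    funext x
    rw [← sq_abs, hdiff]
    split_ifs <;> norm_num
  have hmain : ∀ l : ℝ, l * V ≤ ∑ i, Inf i + Real.exp (l - 1) * ∑ i, Inf i ^ 2 := by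
    intro l
    have h := mul_cubeVar_le hp' F l
    simp only [hInf, hEnergy] at h
    exact h
  have hS : 0 ≤ ∑ i, Inf i := Finset.sum_nonneg fun i _ => hInf0 i
  have hle : ∀ i, Inf i ≤ M := fun i => Finset.le_sup' (fun i => Inf i) (Finset.mem_univ i)
  have hM0 : 0 ≤ M := (hInf0 ⟨0, hN⟩).trans (hle _)
  have hlog : 1 ≤ Real.log (2 / (p * (1 - p))) := by
    have hpq : 0 < p * (1 - p) := mul_pos hp.1 (sub_pos.2 hp.2)
    rw [Real.le_log_iff_exp_le (by positivity), le_div_iff₀ hpq]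
    nlinarith [sq_nonneg (2 * p - 1), Real.exp_one_lt_d9, Real.exp_pos 1]
  have hV : 0 ≤ V := sub_nonneg.2 (sq_cubeExp_le hp' F)
  have hVL : V * Real.log (1 / M) ≤ 2 * ∑ i, Inf i := by
    rcases hM0.eq_or_lt with h0 | h0
    · rw [← h0]
      simpa using hS
    have h := hmain (1 + Real.log (1 / M))
    rw [add_sub_cancel_left, Real.exp_log (by positivity)] at h
    have hsq : 1 / M * ∑ i, Inf i ^ 2 ≤ ∑ i, Inf i := by
      rw [Finset.mul_sum]
      refine Finset.sum_le_sum fun i _ => ?_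
      rw [one_div_mul_eq_div, div_le_iff₀ h0, sq]
      exact mul_le_mul_of_nonneg_left (hle i) (hInf0 i)
    linarith
  rw [mul_assoc, div_mul_eq_mul_div, div_le_iff₀ (by linarith)]
  nlinarith
end
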